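/- For every λ ∈ h*, the annihilator in U of the Verma module Δ(λ) is centrally generated: Ann_U(Δ(λ)) = U·Ann_{Z(s)}(Δ(λ)); equivalently, Ann_U(Δ(λ)) is the two-sided ideal U·m_λ generated by z - λ(z) and c - ϑ_λ, where ϑ_λ = (λ(h)² + 3λ(h) + 2)λ(z). -/

import Mathlib

namespace Schrodinger

noncomputable section

open scoped TensorProduct

/-- Generators of the Schrödinger algebra. -/
inductive Gen : Type
  | E | H | F | P | Q | Z
  deriving DecidableEq

/-- The free algebra on the generators. -/
abbrev FA : Type := FreeAlgebra ℂ Gen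

/-- Inclusion of generators. -/
def ιg (g : Gen) : FA := FreeAlgebra.ι ℂ g

/-- The defining relations of the universal enveloping algebra of the Schrödinger
algebra `s`: `z` is central and `[h,e]=2e`, `[e,f]=h`, `[h,f]=-2f`, `[e,q]=p`,
`[e,p]=0`, `[h,p]=p`, `[f,p]=q`, `[f,q]=0`, `[h,q]=-q`, `[p,q]=z`. -/
inductive Rel : FA → FA → Prop
  | he : Rel (ιg .H * ιg .E) (ιg .E * ιg .H + 2 * ιg .E)
  | ef : Rel (ιg .E * ιg .F) (ιg .F * ιg .E + ιg .H)
  | hf : Rel (ιg .H * ιg .F) (ιg .F * ιg .H - 2 * ιg .F)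
  | eq : Rel (ιg .E * ιg .Q) (ιg .Q * ιg .E + ιg .P)
  | ep : Rel (ιg .E * ιg .P) (ιg .P * ιg .E)
  | hp : Rel (ιg .H * ιg .P) (ιg .P * ιg .H + ιg .P)
  | fp : Rel (ιg .F * ιg .P) (ιg .P * ιg .F + ιg .Q)
  | fq : Rel (ιg .F * ιg .Q) (ιg .Q * ιg .F)
  | hq : Rel (ιg .H * ιg .Q) (ιg .Q * ιg .H - ιg .Q)
  | pq : Rel (ιg .P * ιg .Q) (ιg .Q * ιg .P + ιg .Z)
  | ze : Rel (ιg .Z * ιg .E) (ιg .E * ιg .Z)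
  | zh : Rel (ιg .Z * ιg .H) (ιg .H * ιg .Z)
  | zf : Rel (ιg .Z * ιg .F) (ιg .F * ιg .Z)
  | zp : Rel (ιg .Z * ιg .P) (ιg .P * ιg .Z)
  | zq : Rel (ιg .Z * ιg .Q) (ιg .Q * ιg .Z)

/-- The universal enveloping algebra `U = U(s)` of the Schrödinger algebra,
presented by generators and relations (via the PBW theorem). -/
abbrev U : Type := RingQuot Rel

/-- The generators of `U`. -/
def gen (g : Gen) : U := RingQuot.mkAlgHom ℂ Rel (ιg g)

def E : U := gen .E
def H : U := gen .H
def F : U := gen .F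
def P : U := gen .P
def Q : U := gen .Q
def Z : U := gen .Z

/-- Scalars inside `U`. -/
def sc (a : ℂ) : U := algebraMap ℂ U a

/-- The Casimir element `c = (h² + h + 4fe)z − 2(fp² − eq² − hpq)`. -/
def cElt : U := (H * H + H + 4 * (F * E)) * Z - 2 * (F * (P * P) - E * (Q * Q) - H * (P * Q))

/-- The left ideal of `U` defining the Verma module `Δ(λ)` for
`λ ∈ 𝔥*` with `λ(h) = hh`, `λ(z) = zz`:  it is generated by `n₊ = span{e,p}`
together with `h - λ(h)` and `z - λ(z)`; then
`Δ(λ) = U ⊗_{U(𝔟)} ℂ_λ ≅ U / U(e, p, h - λ(h), z - λ(z))`. -/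
def vermaIdeal (hh zz : ℂ) : Submodule U U :=
  Submodule.span U ({E, P, H - sc hh, Z - sc zz} : Set U)

/-- The Verma module `Δ(λ)` with highest weight `λ`, `λ(h) = hh`, `λ(z) = zz`. -/
abbrev Verma (hh zz : ℂ) : Type := U ⧸ vermaIdeal hh zz

/-- The canonical highest weight generator `v_λ` of `Δ(λ)`. -/
def hwVec (hh zz : ℂ) : Verma hh zz := Submodule.Quotient.mk 1

/-- The unique maximal submodule `K(λ)` of `Δ(λ)`. -/
def vermaRad (hh zz : ℂ) : Submodule U (Verma hh zz) := sSup {N : Submodule U (Verma hh zz) | N ≠ ⊤}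

/-- The simple highest weight module `L(λ) = Δ(λ)/K(λ)`. -/
abbrev SimpleHW (hh zz : ℂ) : Type := Verma hh zz ⧸ vermaRad hh zz

/-- The scalar `ϑ_λ = (λ(h)² + 3λ(h) + 2)·λ(z)` by which the Casimir element `c`
acts on the Verma module `Δ(λ)`. -/
def vartheta (hh zz : ℂ) : ℂ := (hh ^ 2 + 3 * hh + 2) * zz

end

end Schrodinger

namespace Schrodinger

noncomputable section

theorem mk_rel {a b : FA} (h : Rel a b) :
    RingQuot.mkAlgHom ℂ Rel a = RingQuot.mkAlgHom ℂ Rel b :=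
  RingQuot.mkAlgHom_rel ℂ h

theorem H_mul_E : H * E = E * H + (E + E) := by simpa [H, E, gen, two_mul] using mk_rel Rel.he
theorem E_mul_F : E * F = F * E + H := by simpa [H, E, F, gen] using mk_rel Rel.ef
theorem H_mul_F : H * F = F * H - (F + F) := by simpa [H, F, gen, two_mul] using mk_rel Rel.hf
theorem E_mul_Q : E * Q = Q * E + P := by simpa [E, P, Q, gen] using mk_rel Rel.eq
theorem E_mul_P : E * P = P * E := by simpa [E, P, gen] using mk_rel Rel.ep
theorem H_mul_P : H * P = P * H + P := by simpa [H, P, gen] using mk_rel Rel.hp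
theorem F_mul_P : F * P = P * F + Q := by simpa [F, P, Q, gen] using mk_rel Rel.fp
theorem F_mul_Q : F * Q = Q * F := by simpa [F, Q, gen] using mk_rel Rel.fq
theorem H_mul_Q : H * Q = Q * H - Q := by simpa [H, Q, gen] using mk_rel Rel.hq
theorem P_mul_Q : P * Q = Q * P + Z := by simpa [P, Q, Z, gen] using mk_rel Rel.pq
theorem Z_mul_E : Z * E = E * Z := by simpa [E, Z, gen] using mk_rel Rel.ze
theorem Z_mul_H : Z * H = H * Z := by simpa [H, Z, gen] using mk_rel Rel.zh
theorem Z_mul_F : Z * F = F * Z := by simpa [F, Z, gen] using mk_rel Rel.zf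
theorem Z_mul_P : Z * P = P * Z := by simpa [P, Z, gen] using mk_rel Rel.zp
theorem Z_mul_Q : Z * Q = Q * Z := by simpa [Q, Z, gen] using mk_rel Rel.zq

theorem left_mul_rel {x y r : U} (h : x * y = r) (w : U) : x * (y * w) = r * w := by
  rw [← mul_assoc, h]

theorem adjoin_range_gen : Algebra.adjoin ℂ (Set.range gen) = ⊤ := by
  rw [eq_top_iff]
  rintro u -
  obtain ⟨a, rfl⟩ := RingQuot.mkAlgHom_surjective ℂ Rel u
  induction a using FreeAlgebra.induction with
  | grade0 r => rw [AlgHom.commutes]; exact Subalgebra.algebraMap_mem _ r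
  | grade1 g => exact Algebra.subset_adjoin ⟨g, rfl⟩
  | mul a b ha hb => rw [map_mul]; exact mul_mem ha hb
  | add a b ha hb => rw [map_add]; exact add_mem ha hb

theorem commute_of_commute_gen {x : U} (h : ∀ g, Commute x (gen g)) (u : U) : Commute x u := by
  have hu : u ∈ Algebra.adjoin ℂ (Set.range gen) := by simp [adjoin_range_gen]
  induction hu using Algebra.adjoin_induction with
  | mem y hy => obtain ⟨g, rfl⟩ := hy; exact h g
  | algebraMap r => exact (Algebra.commutes r x).symm
  | add a b _ _ ha hb => exact ha.add_right hb
  | mul a b _ _ ha hb => exact ha.mul_right hb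

theorem commute_Z (u : U) : Commute Z u := by
  refine commute_of_commute_gen (fun g => ?_) u
  cases g
  exacts [Z_mul_E, Z_mul_H, Z_mul_F, Z_mul_P, Z_mul_Q, Commute.refl Z]

theorem four_mul_eq (x : U) : 4 * x = x + x + (x + x) := by
  rw [← two_mul, ← two_mul, ← mul_assoc]; norm_num

set_option linter.unusedSimpArgs false in
theorem commute_cElt (u : U) : Commute cElt u := by
  refine commute_of_commute_gen (fun g => ?_) u
  cases g
  on_goal 1 => change cElt * E = E * cElt
  on_goal 2 => change cElt * H = H * cElt
  on_goal 3 => change cElt * F = F * cElt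
  on_goal 4 => change cElt * P = P * cElt
  on_goal 5 => change cElt * Q = Q * cElt
  on_goal 6 => exact (commute_Z cElt).symm
  all_goals
    simp only [cElt, two_mul, four_mul_eq, mul_add, add_mul, mul_sub, sub_mul, mul_assoc, H_mul_E,
      E_mul_F, H_mul_F, E_mul_Q, E_mul_P, H_mul_P, F_mul_P, F_mul_Q, H_mul_Q, P_mul_Q, Z_mul_E,
      Z_mul_H, Z_mul_F, Z_mul_P, Z_mul_Q, left_mul_rel H_mul_E, left_mul_rel E_mul_F,
      left_mul_rel H_mul_F, left_mul_rel E_mul_Q, left_mul_rel E_mul_P, left_mul_rel H_mul_P,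
      left_mul_rel F_mul_P, left_mul_rel F_mul_Q, left_mul_rel H_mul_Q, left_mul_rel P_mul_Q,
      left_mul_rel Z_mul_E, left_mul_rel Z_mul_H, left_mul_rel Z_mul_F, left_mul_rel Z_mul_P,
      left_mul_rel Z_mul_Q]
    abel

set_option linter.unusedSimpArgs false in
theorem cElt_eq : cElt = (H * H + 3 * H + 2) * Z + (4 * (F * Z) + 2 * (Q * Q)) * E +
    (4 * Q + 2 * (H * Q) - 2 * (F * P)) * P := by
  have h3 (x : U) : 3 * x = x + (x + x) := by rw [← two_mul, ← one_add_mul]; norm_num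
  simp only [cElt, h3, two_mul, four_mul_eq, mul_add, add_mul, mul_sub, sub_mul, mul_assoc, H_mul_E,
    E_mul_F, H_mul_F, E_mul_Q, E_mul_P, H_mul_P, F_mul_P, F_mul_Q, H_mul_Q, P_mul_Q, Z_mul_E,
    Z_mul_H, Z_mul_F, Z_mul_P, Z_mul_Q, left_mul_rel H_mul_E, left_mul_rel E_mul_F,
    left_mul_rel H_mul_F, left_mul_rel E_mul_Q, left_mul_rel E_mul_P, left_mul_rel H_mul_P,
    left_mul_rel F_mul_P, left_mul_rel F_mul_Q, left_mul_rel H_mul_Q, left_mul_rel P_mul_Q,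
    left_mul_rel Z_mul_E, left_mul_rel Z_mul_H, left_mul_rel Z_mul_F, left_mul_rel Z_mul_P,
    left_mul_rel Z_mul_Q]
  abel

theorem two_mul_Q_mul_Q_mul_E : 2 * (Q * Q * E) = cElt - (H * H + H + 4 * (F * E)) * Z +
    2 * (F * P * P) - 2 * (H * P * Q) - 4 * (Q * P) - 2 * Z := by
  simp only [cElt, two_mul, four_mul_eq, mul_add, add_mul, mul_sub, mul_assoc, E_mul_Q, P_mul_Q,
    left_mul_rel E_mul_Q]
  abel

/-- The left ideal of `U` generated by the central elements `z - λ(z)` and `c - ϑ_λ`. -/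
def centralIdeal (hh zz : ℂ) : Ideal U :=
  Submodule.span U ({Z - sc zz, cElt - sc (vartheta hh zz)} : Set U)

theorem Z_sub_mem_vermaIdeal (hh zz : ℂ) : Z - sc zz ∈ vermaIdeal hh zz :=
  Submodule.subset_span (by simp)

theorem sc_commute (a : ℂ) (u : U) : Commute (sc a) u := Algebra.commutes a u

theorem cElt_sub_mem_vermaIdeal (hh zz : ℂ) :
    cElt - sc (vartheta hh zz) ∈ vermaIdeal hh zz := by
  have hE : E ∈ vermaIdeal hh zz := Submodule.subset_span (by simp)
  have hP : P ∈ vermaIdeal hh zz := Submodule.subset_span (by simp)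
  have hH : H - sc hh ∈ vermaIdeal hh zz := Submodule.subset_span (by simp)
  have key : cElt - sc (vartheta hh zz) = (H * H + 3 * H + 2) * (Z - sc zz) +
      (4 * (F * Z) + 2 * (Q * Q)) * E + (4 * Q + 2 * (H * Q) - 2 * (F * P)) * P +
      (sc zz * (H + sc hh + 3)) * (H - sc hh) := by
    have h1 : sc (vartheta hh zz) = sc zz * (sc hh * sc hh + 3 * sc hh + 2) := by
      simp only [sc, vartheta, map_mul, map_add, map_pow, map_ofNat]
      rw [(Algebra.commutes zz _).symm, sq]
    have h2 : sc hh * H = H * sc hh := sc_commute hh H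
    have h3 (x : U) : x * sc zz = sc zz * x := (sc_commute zz x).symm.eq
    rw [cElt_eq, h1, mul_sub (H * H + 3 * H + 2), h3]
    simp only [mul_sub, mul_add, add_mul, mul_assoc, h2]
    abel
  rw [key]
  exact add_mem (add_mem (add_mem (Submodule.smul_mem _ _ (Z_sub_mem_vermaIdeal hh zz))
    (Submodule.smul_mem _ _ hE)) (Submodule.smul_mem _ _ hP)) (Submodule.smul_mem _ _ hH)

theorem smul_verma_eq_zero_of_mem {hh zz : ℂ} {u : U} (hu : u ∈ centralIdeal hh zz)
    (v : Verma hh zz) : u • v = 0 := by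
  have central {x : U} (hx : x ∈ vermaIdeal hh zz) (hc : ∀ w, Commute x w) (v : Verma hh zz) :
      x • v = 0 := by
    obtain ⟨w, rfl⟩ := Submodule.Quotient.mk_surjective _ v
    rw [← Submodule.Quotient.mk_smul, Submodule.Quotient.mk_eq_zero, smul_eq_mul, (hc w).eq]
    exact Submodule.smul_mem _ _ hx
  induction hu using Submodule.span_induction with
  | mem x hx =>
    rcases hx with rfl | rfl
    · exact central (Z_sub_mem_vermaIdeal hh zz) (fun w => (commute_Z w).sub_left (sc_commute _ w)) v
    · exact central (cElt_sub_mem_vermaIdeal hh zz)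
        (fun w => (commute_cElt w).sub_left (sc_commute _ w)) v
  | zero => exact zero_smul _ _
  | add x y _ _ hx hy => rw [add_smul, hx, hy, add_zero]
  | smul a x _ hx => rw [smul_eq_mul, mul_smul, hx, smul_zero]

instance isTwoSided_centralIdeal (hh zz : ℂ) : (centralIdeal hh zz).IsTwoSided := by
  refine ⟨fun {a} b ha => ?_⟩
  induction ha using Submodule.span_induction with
  | mem x hx =>
    have hxb : Commute x b := by
      rcases hx with rfl | rfl
      · exact (commute_Z b).sub_left (sc_commute _ b)
      · exact (commute_cElt b).sub_left (sc_commute _ b)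
    rw [hxb.eq]
    exact Submodule.smul_mem _ _ (Submodule.subset_span hx)
  | zero => rw [zero_mul]; exact zero_mem _
  | add x y _ _ hx hy => rw [add_mul]; exact add_mem hx hy
  | smul a x _ hx => rw [smul_eq_mul, mul_assoc]; exact Submodule.smul_mem _ _ hx

section Straightening

variable {A ι : Type*} [Ring A] [Algebra ℂ A]

theorem list_prod_mem_pow {V : Submodule ℂ A} {φ : ι → A} (hφ : ∀ g, φ g ∈ V) (l : List ι) :
    (l.map φ).prod ∈ V ^ l.length := by
  induction l with
  | nil => simpa using (⟨1, map_one _⟩ : ∃ y, algebraMap ℂ A y = 1)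
  | cons g l ih =>
    rw [List.map_cons, List.prod_cons, List.length_cons, pow_succ']
    exact Submodule.mul_mem_mul (hφ g) ih

/-- If the generating family `φ` has all its commutators in `V`, then reordering a word of length
`n + 1` changes its value only by an element of `V ^ n`. -/
theorem prod_sub_prod_mem_of_perm {V : Submodule ℂ A} {φ : ι → A} (hφ : ∀ g, φ g ∈ V)
    (hcomm : ∀ g g', φ g * φ g' - φ g' * φ g ∈ V) {l l' : List ι} (h : l.Perm l') :
    ∀ n, l.length = n + 1 → (l.map φ).prod - (l'.map φ).prod ∈ V ^ n := by
  induction h with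
  | nil => simp
  | @cons g l l' h ih =>
    intro n hn
    rcases n with _ | n
    · have hl : l = [] := List.length_eq_zero_iff.mp (by simpa using hn)
      subst hl
      simp [List.nil_perm.mp h]
    · rw [List.map_cons, List.map_cons, List.prod_cons, List.prod_cons, ← mul_sub, pow_succ']
      exact Submodule.mul_mem_mul (hφ g) (ih n (by simpa using hn))
  | swap g g' l =>
    intro n hn
    have hn' : n = l.length + 1 := by simpa using hn.symm
    have : ((g' :: g :: l).map φ).prod - ((g :: g' :: l).map φ).prod =
        (φ g' * φ g - φ g * φ g') * (l.map φ).prod := by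
      simp only [List.map_cons, List.prod_cons, sub_mul, mul_assoc]
    rw [this, hn', pow_succ']
    exact Submodule.mul_mem_mul (hcomm _ _) (list_prod_mem_pow hφ l)
  | trans h₁ _ ih₁ ih₂ =>
    intro n hn
    simpa using add_mem (ih₁ n hn) (ih₂ n (h₁.length_eq ▸ hn))

end Straightening

/-- Exponents of a monomial `fᵃ pᶜ qᵈ eᵏ hᵇ`. -/
structure Exps where
  a : ℕ
  c : ℕ
  d : ℕ
  k : ℕ
  b : ℕ
  deriving DecidableEq

namespace Exps

/-- The total degree of a monomial. -/
def deg (s : Exps) : ℕ := s.a + s.c + s.d + s.k + s.b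

/-- A monomial is normal if it does not contain `q² e`. -/
def Normal (s : Exps) : Prop := s.k = 0 ∨ s.d ≤ 1

/-- The ordered word in the generators with given exponents. -/
def word (s : Exps) : List Gen :=
  List.replicate s.a Gen.F ++ (List.replicate s.c Gen.P ++ (List.replicate s.d Gen.Q ++
    (List.replicate s.k Gen.E ++ List.replicate s.b Gen.H)))

theorem length_word (s : Exps) : s.word.length = s.deg := by
  simp only [word, deg, List.length_append, List.length_replicate]
  ring

/-- The monomial `fᵃ pᶜ qᵈ eᵏ hᵇ` for a family of values of the generators. -/
def mono {A : Type*} [Monoid A] (φ : Gen → A) (s : Exps) : A := (s.word.map φ).prod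

theorem mono_eq {A : Type*} [Monoid A] (φ : Gen → A) (s : Exps) :
    s.mono φ = φ .F ^ s.a * (φ .P ^ s.c * (φ .Q ^ s.d * (φ .E ^ s.k * φ .H ^ s.b))) := by
  simp [mono, word]

theorem cons_word_perm (g : Gen) (hg : g ≠ .Z) (s : Exps) :
    ∃ t : Exps, t.deg = s.deg + 1 ∧ (g :: s.word).Perm t.word := by
  obtain ⟨a, c, d, k, b⟩ := s
  cases g
  case E =>
    refine ⟨⟨a, c, d, k + 1, b⟩, by simp only [deg]; ring, List.perm_iff_count.mpr fun x => ?_⟩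
    cases x <;> simp [word, List.count_replicate]
  case H =>
    refine ⟨⟨a, c, d, k, b + 1⟩, by simp only [deg]; ring, List.perm_iff_count.mpr fun x => ?_⟩
    cases x <;> simp [word, List.count_replicate]
  case F =>
    refine ⟨⟨a + 1, c, d, k, b⟩, by simp only [deg]; ring, List.perm_iff_count.mpr fun x => ?_⟩
    cases x <;> simp [word, List.count_replicate]
  case P =>
    refine ⟨⟨a, c + 1, d, k, b⟩, by simp only [deg]; ring, List.perm_iff_count.mpr fun x => ?_⟩
    cases x <;> simp [word, List.count_replicate]
  case Q =>
    refine ⟨⟨a, c, d + 1, k, b⟩, by simp only [deg]; ring, List.perm_iff_count.mpr fun x => ?_⟩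
    cases x <;> simp [word, List.count_replicate]
  case Z => exact absurd rfl hg

end Exps

section Span

variable {A : Type*} [Ring A] [Algebra ℂ A] {φ : Gen → A} {zz θ : ℂ}

/-- The span of `1` and the generators. -/
def genSpan (φ : Gen → A) : Submodule ℂ A := Submodule.span ℂ (insert 1 (Set.range φ))

theorem one_mem_genSpan : (1 : A) ∈ genSpan φ := Submodule.subset_span (by simp)

theorem mem_genSpan (g : Gen) : φ g ∈ genSpan φ := Submodule.subset_span (by simp)

theorem genSpan_pow_mono : Monotone fun n => genSpan φ ^ n :=
  pow_right_mono₀ (Submodule.one_le.mpr one_mem_genSpan)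

/-- The span of the normal monomials of degree at most `n`. -/
def normalSpan (φ : Gen → A) (n : ℕ) : Submodule ℂ A :=
  Submodule.span ℂ ((fun s : Exps => s.mono φ) '' {s | s.Normal ∧ s.deg ≤ n})

theorem normalSpan_mono : Monotone (normalSpan φ) := fun _ _ h =>
  Submodule.span_mono (Set.image_mono fun _ hs => ⟨hs.1, hs.2.trans h⟩)

/-- Assuming that words of length `n` can be straightened, so can monomials of degree `n + 1`,
by means of the Casimir relation expressing `q² e`. -/
theorem mono_mem_normalSpan
    (hcomm : ∀ g g', φ g * φ g' - φ g' * φ g ∈ genSpan φ)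
    (hcas : φ .Q * φ .Q * φ .E - (φ .F * φ .P * φ .P - φ .H * φ .P * φ .Q) ∈ genSpan φ ^ 2)
    {n : ℕ} (ih : genSpan φ ^ n ≤ normalSpan φ n) (k : ℕ) :
    ∀ a c d b : ℕ, a + c + d + k + b ≤ n + 1 →
      (⟨a, c, d, k, b⟩ : Exps).mono φ ∈ normalSpan φ (n + 1) := by
  induction k with
  | zero =>
    intro a c d b h
    exact Submodule.subset_span ⟨⟨a, c, d, 0, b⟩, ⟨Or.inl rfl, h⟩, rfl⟩
  | succ k ihk =>
    intro a c d b h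
    rcases lt_or_ge d 2 with hd | hd
    · exact Submodule.subset_span
        ⟨⟨a, c, d, k + 1, b⟩, ⟨Or.inr (Nat.lt_succ_iff.mp hd), h⟩, rfl⟩
    obtain ⟨d, rfl⟩ := Nat.exists_eq_add_of_le' hd
    have up : genSpan φ ^ n ≤ normalSpan φ (n + 1) := ih.trans (normalSpan_mono n.le_succ)
    set r : Exps := ⟨a, c, d, k, b⟩ with hr
    have hrdeg : r.deg + 2 ≤ n := by simp only [hr, Exps.deg]; omega
    have swap {l : List Gen} {s : Exps} (hp : l.Perm s.word) (hl : l.length = r.deg + 3) :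
        (l.map φ).prod - s.mono φ ∈ normalSpan φ (n + 1) :=
      up (genSpan_pow_mono hrdeg (prod_sub_prod_mem_of_perm mem_genSpan hcomm hp (r.deg + 2) hl))
    have h1 : ((Gen.Q :: Gen.Q :: Gen.E :: r.word).map φ).prod -
        (⟨a, c, d + 2, k + 1, b⟩ : Exps).mono φ ∈ normalSpan φ (n + 1) := by
      refine swap (List.perm_iff_count.mpr fun x => ?_) (by simp [Exps.length_word])
      cases x <;> simp [hr, Exps.word, List.count_replicate]
    have h2 : ((Gen.F :: Gen.P :: Gen.P :: r.word).map φ).prod -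
        (⟨a + 1, c + 2, d, k, b⟩ : Exps).mono φ ∈ normalSpan φ (n + 1) := by
      refine swap (List.perm_iff_count.mpr fun x => ?_) (by simp [Exps.length_word])
      cases x <;> simp [hr, Exps.word, List.count_replicate]
    have h3 : ((Gen.H :: Gen.P :: Gen.Q :: r.word).map φ).prod -
        (⟨a, c + 1, d + 1, k, b + 1⟩ : Exps).mono φ ∈ normalSpan φ (n + 1) := by
      refine swap (List.perm_iff_count.mpr fun x => ?_) (by simp [Exps.length_word])
      cases x <;> simp [hr, Exps.word, List.count_replicate]
    have h4 := ihk (a + 1) (c + 2) d b (by omega)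
    have h5 := ihk a (c + 1) (d + 1) (b + 1) (by omega)
    have h6 : (φ .Q * φ .Q * φ .E - (φ .F * φ .P * φ .P - φ .H * φ .P * φ .Q)) * r.mono φ ∈
        normalSpan φ (n + 1) := by
      refine up (genSpan_pow_mono hrdeg ?_)
      change _ ∈ genSpan φ ^ (r.deg + 2)
      rw [add_comm, pow_add]
      refine Submodule.mul_mem_mul hcas ?_
      rw [← Exps.length_word]
      exact list_prod_mem_pow mem_genSpan _
    have key := add_mem (sub_mem h6 h1) (sub_mem (add_mem h2 h4) (add_mem h3 h5))
    convert key using 1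
    simp only [List.map_cons, List.prod_cons, Exps.mono, sub_mul, mul_assoc]
    abel

theorem genSpan_pow_le_normalSpan (hZ : φ .Z = algebraMap ℂ A zz)
    (hcomm : ∀ g g', φ g * φ g' - φ g' * φ g ∈ genSpan φ)
    (hcas : φ .Q * φ .Q * φ .E - (φ .F * φ .P * φ .P - φ .H * φ .P * φ .Q) ∈ genSpan φ ^ 2)
    (n : ℕ) : genSpan φ ^ n ≤ normalSpan φ n := by
  induction n with
  | zero =>
    rw [pow_zero, Submodule.one_le]
    exact Submodule.subset_span ⟨⟨0, 0, 0, 0, 0⟩, ⟨Or.inl rfl, le_rfl⟩, by simp [Exps.mono_eq]⟩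
  | succ n ih =>
    have up : normalSpan φ n ≤ normalSpan φ (n + 1) := normalSpan_mono n.le_succ
    rw [pow_succ', genSpan]
    refine (mul_le_mul_right ih _).trans ?_
    rw [normalSpan, Submodule.span_mul_span, Submodule.span_le]
    rintro _ ⟨x, hx, _, ⟨s, hs, rfl⟩, rfl⟩
    have hmem : s.mono φ ∈ normalSpan φ n := Submodule.subset_span ⟨s, hs, rfl⟩
    rcases hx with rfl | ⟨g, rfl⟩
    · simpa using up hmem
    · by_cases hg : g = .Z
      · subst hg
        simp only [hZ, SetLike.mem_coe, ← Algebra.smul_def]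
        exact Submodule.smul_mem _ _ (up hmem)
      · obtain ⟨t, ht, hp⟩ := Exps.cons_word_perm g hg s
        have h1 := prod_sub_prod_mem_of_perm mem_genSpan hcomm hp s.deg
          (by simp [Exps.length_word])
        have h2 : t.mono φ ∈ normalSpan φ (n + 1) :=
          mono_mem_normalSpan hcomm hcas ih t.k t.a t.c t.d t.b (by
            have := hs.2
            simp only [Exps.deg] at ht this
            omega)
        have h3 := add_mem (up (ih (genSpan_pow_mono hs.2 h1))) h2
        rw [Exps.mono, sub_add_cancel, List.map_cons, List.prod_cons] at h3
        exact h3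

/-- The normal monomials span. -/
theorem span_normal_eq_top (hadj : Algebra.adjoin ℂ (Set.range φ) = ⊤)
    (hZ : φ .Z = algebraMap ℂ A zz)
    (hcomm : ∀ g g', φ g * φ g' - φ g' * φ g ∈ genSpan φ)
    (hcas : φ .Q * φ .Q * φ .E - (φ .F * φ .P * φ .P - φ .H * φ .P * φ .Q) ∈ genSpan φ ^ 2) :
    Submodule.span ℂ ((fun s : Exps => s.mono φ) '' {s | s.Normal}) = ⊤ := by
  rw [eq_top_iff]
  rintro x -
  have hx : x ∈ Algebra.adjoin ℂ (Set.range φ) := by simp [hadj]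
  have key : ∃ n, x ∈ genSpan φ ^ n := by
    induction hx using Algebra.adjoin_induction with
    | mem y hy => obtain ⟨g, rfl⟩ := hy; exact ⟨1, by simpa using mem_genSpan g⟩
    | algebraMap r => exact ⟨0, by simp⟩
    | add a b _ _ ha hb =>
      obtain ⟨n, hn⟩ := ha
      obtain ⟨m, hm⟩ := hb
      exact ⟨max n m, add_mem (genSpan_pow_mono (le_max_left _ _) hn)
        (genSpan_pow_mono (le_max_right _ _) hm)⟩
    | mul a b _ _ ha hb =>
      obtain ⟨n, hn⟩ := ha
      obtain ⟨m, hm⟩ := hb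
      exact ⟨n + m, by rw [pow_add]; exact Submodule.mul_mem_mul hn hm⟩
  obtain ⟨n, hn⟩ := key
  exact Submodule.span_mono (Set.image_mono fun s hs => hs.1)
    (genSpan_pow_le_normalSpan hZ hcomm hcas n hn)

end Span

/-- The space of Laurent polynomials in two variables, carrying the extension of the Verma
module structure on polynomials. -/
abbrev Laurent : Type := (ℤ × ℤ) →₀ ℂ

/-- The basis monomials. -/
def δ (i j : ℤ) : Laurent := Finsupp.single (i, j) 1

/-- The linear operator with prescribed values on the basis. -/
def opOf (w : ℤ → ℤ → Laurent) : Module.End ℂ Laurent :=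
  Finsupp.linearCombination ℂ fun x : ℤ × ℤ => w x.1 x.2

theorem opOf_δ (w : ℤ → ℤ → Laurent) (i j : ℤ) : opOf w (δ i j) = w i j := by
  simp [opOf, δ]

theorem end_ext {S T : Module.End ℂ Laurent} (h : ∀ i j, S (δ i j) = T (δ i j)) : S = T := by
  refine Finsupp.lhom_ext' fun x => LinearMap.ext_ring ?_
  exact h x.1 x.2

/-- The action of the generators on Laurent monomials. -/
def genOp (hh zz : ℂ) : Gen → Module.End ℂ Laurent
  | .F => opOf fun i j => δ (i + 1) j
  | .Q => opOf fun i j => δ i (j + 1)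
  | .P => opOf fun i j => (zz * j) • δ i (j - 1) - (i : ℂ) • δ (i - 1) (j + 1)
  | .H => opOf fun i j => (hh - 2 * i - j) • δ i j
  | .E => opOf fun i j => (i * (hh - j - i + 1)) • δ (i - 1) j +
      (zz / 2 * j * (j - 1)) • δ i (j - 2)
  | .Z => zz • 1

variable {hh zz : ℂ}

theorem genOp_F (i j : ℤ) : genOp hh zz .F (δ i j) = δ (i + 1) j := by
  simp only [genOp, opOf_δ]
theorem genOp_Q (i j : ℤ) : genOp hh zz .Q (δ i j) = δ i (j + 1) := by
  simp only [genOp, opOf_δ]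
theorem genOp_P (i j : ℤ) : genOp hh zz .P (δ i j) =
    (zz * j) • δ i (j - 1) - (i : ℂ) • δ (i - 1) (j + 1) := by
  simp only [genOp, opOf_δ]
theorem genOp_H (i j : ℤ) : genOp hh zz .H (δ i j) = (hh - 2 * i - j) • δ i j := by
  simp only [genOp, opOf_δ]
theorem genOp_E (i j : ℤ) : genOp hh zz .E (δ i j) = (i * (hh - j - i + 1)) • δ (i - 1) j +
    (zz / 2 * j * (j - 1)) • δ i (j - 2) := by
  simp only [genOp, opOf_δ]

theorem genOp_Z (v : Laurent) : genOp hh zz .Z v = zz • v := rfl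

theorem lift_genOp_rel {a b : FA} (h : Rel a b) :
    FreeAlgebra.lift ℂ (genOp hh zz) a = FreeAlgebra.lift ℂ (genOp hh zz) b := by
  cases h <;>
  · refine end_ext fun i j => ?_
    simp only [ιg, map_mul, map_add, map_sub, map_ofNat, FreeAlgebra.lift_ι_apply,
      Module.End.mul_apply, LinearMap.add_apply, LinearMap.sub_apply, genOp_F, genOp_Q, genOp_P,
      genOp_H, genOp_E, genOp_Z, map_smul, smul_add, smul_sub, smul_smul, Module.End.ofNat_apply]
    try push_cast
    try ring_nf
    try module

/-- The action of `U` on Laurent polynomials. -/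
def rep (hh zz : ℂ) : U →ₐ[ℂ] Module.End ℂ Laurent :=
  RingQuot.liftAlgHom ℂ ⟨FreeAlgebra.lift ℂ (genOp hh zz), fun _ _ h => lift_genOp_rel h⟩

theorem rep_gen (g : Gen) : rep hh zz (gen g) = genOp hh zz g := by
  simp [rep, gen, ιg]

theorem rep_sc (a : ℂ) (v : Laurent) : rep hh zz (sc a) v = a • v := by
  rw [sc, AlgHom.commutes, Module.algebraMap_end_apply]

theorem rep_apply_of_mem_vermaIdeal {w : U} (hw : w ∈ vermaIdeal hh zz) :
    rep hh zz w (δ 0 0) = 0 := by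
  induction hw using Submodule.span_induction with
  | mem x hx =>
    rcases hx with rfl | rfl | rfl | rfl
    · simp [E, rep_gen, genOp_E]
    · simp [P, rep_gen, genOp_P]
    · simp [H, rep_gen, genOp_H, rep_sc]
    · simp [Z, rep_gen, genOp_Z, rep_sc]
  | zero => simp
  | add x y _ _ hx hy => rw [map_add, LinearMap.add_apply, hx, hy, add_zero]
  | smul a x _ hx => rw [smul_eq_mul, map_mul, Module.End.mul_apply, hx, map_zero]

theorem rep_F_pow_mul_Q_pow (i j : ℕ) : rep hh zz (F ^ i * Q ^ j) (δ 0 0) = δ i j := by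
  have hQ : rep hh zz (Q ^ j) (δ 0 0) = δ 0 j := by
    induction j with
    | zero => simp
    | succ j ih => rw [pow_succ', map_mul, Module.End.mul_apply, ih, Q, rep_gen, genOp_Q]; simp
  induction i with
  | zero => simpa using hQ
  | succ i ih =>
    rw [pow_succ', mul_assoc, map_mul, Module.End.mul_apply, ih, F, rep_gen, genOp_F]
    simp

theorem rep_δ_eq_zero {u : U} (hu : ∀ v : Verma hh zz, u • v = 0) (i j : ℕ) :
    rep hh zz u (δ i j) = 0 := by
  rw [← rep_F_pow_mul_Q_pow, ← Module.End.mul_apply, ← map_mul]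
  refine rep_apply_of_mem_vermaIdeal ?_
  have := hu (Submodule.Quotient.mk (F ^ i * Q ^ j))
  rwa [← Submodule.Quotient.mk_smul, Submodule.Quotient.mk_eq_zero] at this

section LeadingTerms

/-- Laurent polynomials of degree less than `J` in the second variable. -/
def fil (J : ℤ) : Submodule ℂ Laurent :=
  Submodule.span ℂ {v | ∃ i j : ℤ, j < J ∧ v = δ i j}

theorem δ_mem_fil {i j J : ℤ} (h : j < J) : δ i j ∈ fil J := Submodule.subset_span ⟨i, j, h, rfl⟩

theorem apply_eq_zero_of_mem_fil {J : ℤ} {v : Laurent} (hv : v ∈ fil J) {i j : ℤ} (h : J ≤ j) :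
    v (i, j) = 0 := by
  induction hv using Submodule.span_induction with
  | mem x hx =>
    obtain ⟨i', j', hj, rfl⟩ := hx
    rw [δ, Finsupp.single_apply, if_neg]
    rintro ⟨⟩
    omega
  | zero => rfl
  | add x y _ _ hx hy => rw [Finsupp.add_apply, hx, hy, add_zero]
  | smul a x _ hx => rw [Finsupp.smul_apply, hx, smul_zero]

theorem map_mem_fil {S : Module.End ℂ Laurent} {J K : ℤ}
    (h : ∀ i j : ℤ, j < J → S (δ i j) ∈ fil K) {v : Laurent} (hv : v ∈ fil J) : S v ∈ fil K := by
  induction hv using Submodule.span_induction with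
  | mem x hx => obtain ⟨i, j, hj, rfl⟩ := hx; exact h i j hj
  | zero => rw [map_zero]; exact zero_mem _
  | add x y _ _ hx hy => rw [map_add]; exact add_mem hx hy
  | smul a x _ hx => rw [map_smul]; exact Submodule.smul_mem _ _ hx

/-- `v` has leading term `γ xⁱ yʲ` with respect to the degree in the second variable. -/
def Lead (v : Laurent) (γ : ℂ) (i j : ℤ) : Prop := v - γ • δ i j ∈ fil j

theorem Lead.apply {v : Laurent} {γ : ℂ} {i j i' j' : ℤ} (h : Lead v γ i j) (hj : j ≤ j') :
    v (i', j') = if i = i' ∧ j = j' then γ else 0 := by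
  have := apply_eq_zero_of_mem_fil h (i := i') hj
  rw [Finsupp.sub_apply, Finsupp.smul_apply, sub_eq_zero, δ, Finsupp.single_apply] at this
  simpa [Prod.ext_iff] using this

theorem Lead.map {S : Module.End ℂ Laurent} {f : ℤ → ℤ → ℂ} {m n : ℤ}
    (hS : ∀ i j, Lead (S (δ i j)) (f i j) (i + m) (j + n)) {v : Laurent} {γ : ℂ} {i j : ℤ}
    (h : Lead v γ i j) : Lead (S v) (γ * f i j) (i + m) (j + n) := by
  have h1 : S (v - γ • δ i j) ∈ fil (j + n) := by
    refine map_mem_fil (fun i' j' hj => ?_) h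
    have h2 : fil (j' + n) ≤ fil (j + n) := Submodule.span_mono
      fun _ ⟨i, k, hk, hv⟩ => ⟨i, k, by omega, hv⟩
    have h3 := add_mem (h2 (hS i' j'))
      (Submodule.smul_mem _ (f i' j') (δ_mem_fil (i := i' + m) (by omega : j' + n < j + n)))
    simpa using h3
  have h4 := add_mem h1 (Submodule.smul_mem _ γ (hS i j))
  rw [Lead]
  convert h4 using 1
  rw [map_sub, map_smul]
  module

theorem Lead.map_pow {S : Module.End ℂ Laurent} {f : ℤ → ℤ → ℂ} {m n : ℤ}
    (hS : ∀ i j, Lead (S (δ i j)) (f i j) (i + m) (j + n)) {v : Laurent} {γ : ℂ} {i j : ℤ}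
    (h : Lead v γ i j) (k : ℕ) :
    Lead ((S ^ k) v) (γ * ∏ r ∈ Finset.range k, f (i + r * m) (j + r * n))
      (i + k * m) (j + k * n) := by
  induction k with
  | zero => simpa using h
  | succ k ih =>
    rw [pow_succ', Module.End.mul_apply, Finset.prod_range_succ, ← mul_assoc]
    convert ih.map hS using 1 <;> push_cast <;> ring

theorem lead_self (γ : ℂ) (i j : ℤ) : Lead (γ • δ i j) γ i j := by simp [Lead]

variable {hh zz : ℂ}

theorem lead_F (i j : ℤ) : Lead (genOp hh zz .F (δ i j)) 1 (i + 1) (j + 0) := by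
  simp [genOp_F, Lead]

theorem lead_Q (i j : ℤ) : Lead (genOp hh zz .Q (δ i j)) 1 (i + 0) (j + 1) := by
  simp [genOp_Q, Lead]

theorem lead_H (i j : ℤ) :
    Lead (genOp hh zz .H (δ i j)) (hh - 2 * i - j) (i + 0) (j + 0) := by
  simp [genOp_H, Lead]

theorem lead_P (i j : ℤ) : Lead (genOp hh zz .P (δ i j)) (-i) (i + -1) (j + 1) := by
  have := Submodule.smul_mem _ (zz * j) (δ_mem_fil (i := i) (by omega : j - 1 < j + 1))
  rw [Lead, genOp_P]
  convert this using 1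
  rw [← sub_eq_add_neg]
  module

theorem lead_E (i j : ℤ) :
    Lead (genOp hh zz .E (δ i j)) (i * (hh - j - i + 1)) (i + -1) (j + 0) := by
  have := Submodule.smul_mem _ (zz / 2 * j * (j - 1))
    (δ_mem_fil (i := i) (by omega : j - 2 < j + 0))
  rw [Lead, genOp_E]
  convert this using 1
  rw [← sub_eq_add_neg, add_zero]
  module

open Polynomial in
/-- The polynomial, in `i` over the polynomials in `t`, describing up to sign the leading
coefficient of `fᵃ pᶜ qᵈ eᵏ` at `xⁱ yʲ`, where `t` is the eigenvalue of `h`. -/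
def leadPoly (s : Exps) : ℂ[X][X] :=
  (∏ r ∈ Finset.range s.k, (X - C (C (r : ℂ)))) *
    (∏ r ∈ Finset.range s.k, (X + C (X + C ((r : ℂ) + 1)))) *
    ∏ r ∈ Finset.range s.c, (X - C (C ((s.k : ℂ) + r)))

theorem leadPoly_monic (s : Exps) : (leadPoly s).Monic :=
  ((Polynomial.monic_prod_of_monic _ _ fun _ _ => Polynomial.monic_X_sub_C _).mul
    (Polynomial.monic_prod_of_monic _ _ fun _ _ => Polynomial.monic_X_add_C _)).mul
    (Polynomial.monic_prod_of_monic _ _ fun _ _ => Polynomial.monic_X_sub_C _)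

theorem natDegree_leadPoly (s : Exps) : (leadPoly s).natDegree = 2 * s.k + s.c := by
  have h1 : (∏ r ∈ Finset.range s.k, (Polynomial.X - Polynomial.C (Polynomial.C (r : ℂ)))).Monic :=
    Polynomial.monic_prod_of_monic _ _ fun _ _ => Polynomial.monic_X_sub_C _
  have h2 : (∏ r ∈ Finset.range s.k, (Polynomial.X +
      Polynomial.C (Polynomial.X + Polynomial.C ((r : ℂ) + 1)))).Monic :=
    Polynomial.monic_prod_of_monic _ _ fun _ _ => Polynomial.monic_X_add_C _
  have h3 : (∏ r ∈ Finset.range s.c,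
      (Polynomial.X - Polynomial.C (Polynomial.C ((s.k : ℂ) + r)))).Monic :=
    Polynomial.monic_prod_of_monic _ _ fun _ _ => Polynomial.monic_X_sub_C _
  rw [leadPoly, (h1.mul h2).natDegree_mul h3, h1.natDegree_mul h2,
    Polynomial.natDegree_prod_of_monic _ _ fun _ _ => Polynomial.monic_X_sub_C _,
    Polynomial.natDegree_prod_of_monic _ _ fun _ _ => Polynomial.monic_X_add_C _,
    Polynomial.natDegree_prod_of_monic _ _ fun _ _ => Polynomial.monic_X_sub_C _]
  simp only [Polynomial.natDegree_X_sub_C, Polynomial.natDegree_X_add_C, Finset.sum_const,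
    Finset.card_range, smul_eq_mul]
  ring

theorem lead_mono (s : Exps) (i j : ℤ) :
    Lead (s.mono (genOp hh zz) (δ i j))
      ((hh - 2 * i - j) ^ s.b * (-1) ^ s.c * (leadPoly s).evalEval (hh - 2 * i - j) i)
      (i + s.a - s.c - s.k) (j + s.c + s.d) := by
  have h := ((((lead_self 1 i j).map_pow (S := genOp hh zz .H) lead_H s.b).map_pow
    (S := genOp hh zz .E) lead_E s.k).map_pow (S := genOp hh zz .Q) lead_Q s.d).map_pow
    (S := genOp hh zz .P) lead_P s.c
  have h' := h.map_pow (S := genOp hh zz .F) lead_F s.a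
  rw [one_smul] at h'
  rw [Exps.mono_eq]
  simp only [Module.End.mul_apply]
  convert h' using 1
  · simp only [Finset.prod_const_one, mul_one, one_mul, mul_zero, add_zero, Finset.prod_const,
      Finset.card_range]
    have e1 : ∏ r ∈ Finset.range s.c, (-((i + s.k * -1 + r * -1 : ℤ) : ℂ)) =
        (-1) ^ s.c * ∏ r ∈ Finset.range s.c, ((i : ℂ) - (s.k + r)) := by
      rw [← Finset.card_range s.c, ← Finset.prod_const, Finset.card_range,
        ← Finset.prod_mul_distrib]
      refine Finset.prod_congr rfl fun r _ => ?_
      push_cast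
      ring
    have e2 : ∏ r ∈ Finset.range s.k,
        (((i + r * -1 : ℤ) : ℂ) * (hh - j - ((i + r * -1 : ℤ) : ℂ) + 1)) =
        (∏ r ∈ Finset.range s.k, ((i : ℂ) - r)) *
        ∏ r ∈ Finset.range s.k, ((i : ℂ) + (hh - 2 * i - j + (r + 1))) := by
      rw [← Finset.prod_mul_distrib]
      refine Finset.prod_congr rfl fun r _ => ?_
      push_cast
      ring
    rw [e1, e2, leadPoly]
    simp only [Polynomial.evalEval_mul, Polynomial.evalEval_prod, Polynomial.evalEval_sub,
      Polynomial.evalEval_add, Polynomial.evalEval_X, Polynomial.evalEval_C, Polynomial.eval_C,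
      Polynomial.eval_add, Polynomial.eval_X]
    ring
  · ring
  · ring

end LeadingTerms

section Independence

open Polynomial

theorem eq_zero_of_evalEval_eq_zero {hh : ℂ} {Φ : ℂ[X][X]}
    (h : ∀ i j : ℕ, Φ.evalEval (hh - 2 * i - j) (i : ℂ) = 0) : Φ = 0 := by
  refine Φ.eq_zero_of_infinite_isRoot (Set.Infinite.mono ?_ (Set.infinite_range_of_injective
    (f := fun i : ℕ => (C (i : ℂ) : ℂ[X])) fun i j hij => Nat.cast_injective (C_injective hij)))
  rintro _ ⟨i, rfl⟩
  refine (Φ.eval (C (i : ℂ))).eq_zero_of_infinite_isRoot (Set.Infinite.mono ?_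
    (Set.infinite_range_of_injective (f := fun j : ℕ => hh - 2 * i - (j : ℂ))
      fun j k hjk => Nat.cast_injective (sub_right_injective hjk)))
  rintro _ ⟨j, rfl⟩
  exact h i j

/-- The normal monomials are linearly independent as operators on polynomials. -/
theorem eq_zero_of_sum_mono_apply_eq_zero {hh zz : ℂ} {κ : Exps →₀ ℂ}
    (hκ : ∀ s ∈ κ.support, s.Normal)
    (h : ∀ i j : ℕ, (κ.sum fun s x => x • s.mono (genOp hh zz) (δ i j)) = 0) : κ = 0 := by
  by_contra hne
  obtain ⟨s₀, hs₀, hmax₀⟩ := κ.support.exists_max_image (fun s => s.c + s.d)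
    (Finsupp.support_nonempty_iff.mpr hne)
  set S : Finset Exps := κ.support.filter fun s =>
    s.c + s.d = s₀.c + s₀.d ∧ (s.a - s.c - s.k : ℤ) = s₀.a - s₀.c - s₀.k with hS
  obtain ⟨s₁, hs₁, hmax₁⟩ := S.exists_max_image (fun s => 2 * s.k + s.c)
    ⟨s₀, Finset.mem_filter.mpr ⟨hs₀, rfl, rfl⟩⟩
  set Φ : ℂ[X][X] := ∑ s ∈ S, C (C (κ s * (-1) ^ s.c) * X ^ s.b) * leadPoly s with hΦ
  have hΦ0 : Φ = 0 := by
    refine eq_zero_of_evalEval_eq_zero (hh := hh) fun i j => ?_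
    have h1 := DFunLike.congr_fun (h i j)
      ((i : ℤ) + (s₀.a - s₀.c - s₀.k), (j : ℤ) + (s₀.c + s₀.d))
    rw [Finsupp.sum, Finsupp.finsetSum_apply, Finsupp.zero_apply] at h1
    rw [← h1, hΦ, evalEval_finsetSum, hS, Finset.sum_filter]
    refine Finset.sum_congr rfl fun s hs => ?_
    have hle : s.c + s.d ≤ s₀.c + s₀.d := hmax₀ s hs
    rw [Finsupp.smul_apply, (lead_mono s i j).apply (by omega)]
    by_cases hc : s.c + s.d = s₀.c + s₀.d ∧ (s.a - s.c - s.k : ℤ) = s₀.a - s₀.c - s₀.k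
    · rw [if_pos hc, if_pos (by omega)]
      simp only [evalEval_mul, evalEval_C, eval_mul, eval_C, eval_pow, eval_X, smul_eq_mul,
        Int.cast_natCast]
      ring
    · rw [if_neg hc, if_neg (by omega), smul_zero]
  have hcoeff : (Φ.coeff (2 * s₁.k + s₁.c)).coeff s₁.b = κ s₁ * (-1) ^ s₁.c := by
    rw [hΦ, finsetSum_coeff, finsetSum_coeff, Finset.sum_eq_single s₁]
    · rw [coeff_C_mul, ← natDegree_leadPoly, (leadPoly_monic s₁).coeff_natDegree, mul_one,
        coeff_C_mul_X_pow, if_pos rfl]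
    · intro s hs hss
      rcases (hmax₁ s hs).lt_or_eq with hlt | heq
      · rw [coeff_C_mul, (leadPoly s).coeff_eq_zero_of_natDegree_lt (by rwa [natDegree_leadPoly]),
          mul_zero, coeff_zero]
      · rw [coeff_C_mul, ← heq, ← natDegree_leadPoly, (leadPoly_monic s).coeff_natDegree, mul_one,
          coeff_C_mul_X_pow, if_neg]
        intro hb
        refine hss ?_
        obtain ⟨hs, hsn, hsd⟩ := Finset.mem_filter.mp hs
        obtain ⟨hs₁', hsn₁, hsd₁⟩ := Finset.mem_filter.mp hs₁
        have hN := hκ s hs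
        have hN₁ := hκ s₁ hs₁'
        obtain ⟨a, c, d, k, b⟩ := s
        obtain ⟨a', c', d', k', b'⟩ := s₁
        simp only [Exps.Normal] at *
        simp only [Exps.mk.injEq]
        omega
    · exact fun hn => absurd hs₁ hn
  rw [hΦ0, coeff_zero, coeff_zero] at hcoeff
  have : κ s₁ ≠ 0 := Finsupp.mem_support_iff.mp (Finset.mem_filter.mp hs₁).1
  exact mul_ne_zero this (pow_ne_zero _ (by norm_num)) hcoeff.symm

end Independence

section Quotient

/-- Up to sign, the commutator of `x` and `y` is a multiple of a generator. -/
def BracketGen (x y : Gen) : Prop := ∃ (r : ℂ) (k : Gen),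
  gen x * gen y - gen y * gen x = r • gen k ∨ gen y * gen x - gen x * gen y = r • gen k

theorem bracketGen (x y : Gen) : BracketGen x y := by
  have flip {x y : Gen} : BracketGen x y → BracketGen y x := fun ⟨r, k, h⟩ => ⟨r, k, h.symm⟩
  have of_commute {x y : Gen} (h : gen x * gen y = gen y * gen x) : BracketGen x y :=
    ⟨0, x, Or.inl (by rw [h, sub_self, zero_smul])⟩
  have of_eq {x y k : Gen} (h : gen x * gen y = gen y * gen x + gen k) : BracketGen x y :=
    ⟨1, k, Or.inl (by rw [h, add_sub_cancel_left, one_smul])⟩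
  have hZ (x : Gen) : BracketGen .Z x := of_commute (commute_Z _)
  have hself (x : Gen) : BracketGen x x := of_commute rfl
  have hHE : BracketGen .H .E :=
    ⟨2, .E, Or.inl (by rw [sub_eq_iff_eq_add', two_smul]; exact H_mul_E)⟩
  have hHF : BracketGen .H .F :=
    ⟨2, .F, Or.inr (by rw [two_smul, show gen .H * gen .F = gen .F * gen .H - (gen .F + gen .F) from H_mul_F,
      sub_sub_cancel])⟩
  have hHQ : BracketGen .H .Q :=
    ⟨1, .Q, Or.inr (by rw [one_smul, show gen .H * gen .Q = gen .Q * gen .H - gen .Q from H_mul_Q,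
      sub_sub_cancel])⟩
  have hEF : BracketGen .E .F := of_eq E_mul_F
  have hEQ : BracketGen .E .Q := of_eq E_mul_Q
  have hEP : BracketGen .E .P := of_commute E_mul_P
  have hHP : BracketGen .H .P := of_eq H_mul_P
  have hFP : BracketGen .F .P := of_eq F_mul_P
  have hFQ : BracketGen .F .Q := of_commute F_mul_Q
  have hPQ : BracketGen .P .Q := of_eq P_mul_Q
  cases x <;> cases y <;>
    first | apply hself | apply hZ | assumption | (apply flip; first | apply hZ | assumption)

variable (hh zz : ℂ)

/-- The images of the generators in the quotient of `U` by the central ideal. -/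
def quotGen (g : Gen) : U ⧸ centralIdeal hh zz := Ideal.Quotient.mkₐ ℂ (centralIdeal hh zz) (gen g)

theorem quotGen_Z : quotGen hh zz .Z = algebraMap ℂ _ zz := by
  rw [← AlgHom.commutes (Ideal.Quotient.mkₐ ℂ (centralIdeal hh zz)), quotGen]
  exact Ideal.Quotient.eq.mpr (Submodule.subset_span (by simp [Z, sc]))

theorem mk_cElt : Ideal.Quotient.mkₐ ℂ (centralIdeal hh zz) cElt =
    algebraMap ℂ _ (vartheta hh zz) := by
  rw [← AlgHom.commutes (Ideal.Quotient.mkₐ ℂ (centralIdeal hh zz))]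
  exact Ideal.Quotient.eq.mpr (Submodule.subset_span (by simp [sc]))

theorem mk_mono (s : Exps) : Ideal.Quotient.mkₐ ℂ (centralIdeal hh zz) (s.mono gen) =
    s.mono (quotGen hh zz) := by
  simp only [Exps.mono_eq, map_mul, map_pow, quotGen]

theorem rep_mono (s : Exps) : rep hh zz (s.mono gen) = s.mono (genOp hh zz) := by
  simp only [Exps.mono_eq, map_mul, map_pow, rep_gen]

theorem quotGen_casimir : quotGen hh zz .Q * quotGen hh zz .Q * quotGen hh zz .E -
    (quotGen hh zz .F * quotGen hh zz .P * quotGen hh zz .P -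
      quotGen hh zz .H * quotGen hh zz .P * quotGen hh zz .Q) ∈ genSpan (quotGen hh zz) ^ 2 := by
  have h := congrArg (Ideal.Quotient.mkₐ ℂ (centralIdeal hh zz)) two_mul_Q_mul_Q_mul_E
  simp only [map_mul, map_add, map_sub, mk_cElt, map_ofNat] at h
  change 2 * (quotGen hh zz .Q * quotGen hh zz .Q * quotGen hh zz .E) =
    algebraMap ℂ _ (vartheta hh zz) - (quotGen hh zz .H * quotGen hh zz .H + quotGen hh zz .H +
      4 * (quotGen hh zz .F * quotGen hh zz .E)) * quotGen hh zz .Z +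
      2 * (quotGen hh zz .F * quotGen hh zz .P * quotGen hh zz .P) -
      2 * (quotGen hh zz .H * quotGen hh zz .P * quotGen hh zz .Q) -
      4 * (quotGen hh zz .Q * quotGen hh zz .P) - 2 * quotGen hh zz .Z at h
  have mem2 (g g' : Gen) : quotGen hh zz g * quotGen hh zz g' ∈ genSpan (quotGen hh zz) ^ 2 := by
    rw [sq]; exact Submodule.mul_mem_mul (mem_genSpan g) (mem_genSpan g')
  have mem1 (g : Gen) : quotGen hh zz g ∈ genSpan (quotGen hh zz) ^ 2 :=
    genSpan_pow_mono one_le_two (by simpa using mem_genSpan g)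
  have mem0 : (1 : U ⧸ centralIdeal hh zz) ∈ genSpan (quotGen hh zz) ^ 2 :=
    genSpan_pow_mono one_le_two (by simpa using one_mem_genSpan (φ := quotGen hh zz))
  have key : quotGen hh zz .Q * quotGen hh zz .Q * quotGen hh zz .E -
      (quotGen hh zz .F * quotGen hh zz .P * quotGen hh zz .P -
        quotGen hh zz .H * quotGen hh zz .P * quotGen hh zz .Q) =
      (vartheta hh zz / 2 - zz) • 1 - (zz / 2) • (quotGen hh zz .H * quotGen hh zz .H) -
      (zz / 2) • quotGen hh zz .H - (2 * zz) • (quotGen hh zz .F * quotGen hh zz .E) -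
      (2 : ℂ) • (quotGen hh zz .Q * quotGen hh zz .P) := by
    have two (x : U ⧸ centralIdeal hh zz) : 2 * x = (2 : ℂ) • x := by rw [two_smul, two_mul]
    have four (x : U ⧸ centralIdeal hh zz) : 4 * x = (4 : ℂ) • x := by
      rw [Algebra.smul_def, map_ofNat]
    rw [quotGen_Z, ← Algebra.commutes, ← Algebra.smul_def, Algebra.algebraMap_eq_smul_one,
      Algebra.algebraMap_eq_smul_one] at h
    simp only [two, four] at h
    linear_combination (norm := module) (1 / 2 : ℂ) • h
  rw [key]
  exact sub_mem (sub_mem (sub_mem (sub_mem (Submodule.smul_mem _ _ mem0)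
    (Submodule.smul_mem _ _ (mem2 _ _))) (Submodule.smul_mem _ _ (mem1 _)))
    (Submodule.smul_mem _ _ (mem2 _ _))) (Submodule.smul_mem _ _ (mem2 _ _))

theorem span_mono_quotGen :
    Submodule.span ℂ ((fun s : Exps => s.mono (quotGen hh zz)) '' {s | s.Normal}) = ⊤ := by
  refine span_normal_eq_top ?_ (quotGen_Z hh zz) (fun g g' => ?_) (quotGen_casimir hh zz)
  · have : Set.range (quotGen hh zz) =
        Ideal.Quotient.mkₐ ℂ (centralIdeal hh zz) '' Set.range gen := by
      rw [← Set.range_comp]; rfl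
    rw [this, ← AlgHom.map_adjoin, adjoin_range_gen, Algebra.map_top, AlgHom.range_eq_top]
    exact Ideal.Quotient.mkₐ_surjective _ _
  · obtain ⟨r, k, h⟩ := bracketGen g g'
    have hk := Submodule.smul_mem _ r (mem_genSpan (φ := quotGen hh zz) k)
    rcases h with h | h
    all_goals
      have h' := congrArg (Ideal.Quotient.mkₐ ℂ (centralIdeal hh zz)) h
      rw [map_sub, map_mul, map_mul, map_smul] at h'
    · exact h' ▸ hk
    · rw [← neg_sub]
      exact neg_mem (h' ▸ hk)

end Quotient

theorem mem_centralIdeal_of_smul_verma_eq_zero {hh zz : ℂ} {u : U}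
    (hu : ∀ v : Verma hh zz, u • v = 0) : u ∈ centralIdeal hh zz := by
  have hmem : Ideal.Quotient.mkₐ ℂ (centralIdeal hh zz) u ∈
      Submodule.span ℂ ((fun s : Exps => s.mono (quotGen hh zz)) '' {s | s.Normal}) := by
    rw [span_mono_quotGen]; trivial
  obtain ⟨κ, hκ, hsum⟩ := (Finsupp.mem_span_image_iff_linearCombination ℂ).mp hmem
  have hdiff : Ideal.Quotient.mkₐ ℂ (centralIdeal hh zz) u =
      Ideal.Quotient.mkₐ ℂ (centralIdeal hh zz) (κ.sum fun s x => x • s.mono gen) := by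
    rw [← hsum, Finsupp.linearCombination_apply, map_finsuppSum]
    simp only [map_smul, mk_mono]
  have hsub : u - (κ.sum fun s x => x • s.mono gen) ∈ centralIdeal hh zz :=
    Ideal.Quotient.eq.mp hdiff
  have hκ0 : κ = 0 := by
    refine eq_zero_of_sum_mono_apply_eq_zero (hh := hh) (zz := zz) (fun s hs => hκ hs)
      fun i j => ?_
    have h1 := rep_δ_eq_zero (smul_verma_eq_zero_of_mem hsub) i j
    rw [map_sub, LinearMap.sub_apply, rep_δ_eq_zero hu, zero_sub, neg_eq_zero,
      map_finsuppSum, Finsupp.sum, LinearMap.sum_apply] at h1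
    rw [Finsupp.sum, ← h1]
    exact Finset.sum_congr rfl fun s _ => by rw [map_smul, LinearMap.smul_apply, rep_mono]
  simpa [hκ0] using hsub

end

end Schrodinger

namespace Schrodinger

/-- Theorem 401 of the paper: the annihilator in `U` of the
Verma module `Δ(λ)` is centrally generated; explicitly, it is the two-sided ideal
`U·m_λ = U·(z - λ(z)) + U·(c - ϑ_λ)` generated by the central elements
`z - λ(z)` and `c - ϑ_λ`, where `ϑ_λ = (λ(h)² + 3λ(h) + 2)λ(z)`. -/
theorem verma_annihilator_centrally_generated (hh zz : ℂ) (u : U) :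
    (∀ v : Verma hh zz, u • v = 0) ↔
      u ∈ Submodule.span U ({Z - sc zz, cElt - sc (vartheta hh zz)} : Set U) := by
  exact ⟨mem_centralIdeal_of_smul_verma_eq_zero, smul_verma_eq_zero_of_mem⟩

end Schrodinger
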